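/- Let R be a normal noetherian integral domain. Let G̃_0(R) be the reduced Grothendieck group (the kernel of the rank map G_0(R) → ℤ), and let H ⊆ G̃_0(R) be the subgroup generated by all classes [R/𝔭] with 𝔭 a prime of height at least 2. Then the natural map induces an isomorphism G̃_0(R)/H ≅ Cl(R). -/

import Mathlib

universe u v

/-! ### The Grothendieck group `G₀` of finitely generated modules -/

/-- A bundled finitely generated module over the commutative ring `R`. -/
structure FGMod (R : Type u) [CommRing R] : Type (u + 1) where
  carrier : Type u
  [isAddCommGroup : AddCommGroup carrier]
  [isModule : Module R carrier]
  [isFinite : Module.Finite R carrier]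

attribute [instance] FGMod.isAddCommGroup FGMod.isModule FGMod.isFinite

/-- The bundled finitely generated module attached to a module. -/
def FGMod.of (R : Type u) [CommRing R] (M : Type u) [AddCommGroup M] [Module R M]
    [Module.Finite R M] : FGMod R :=
  ⟨M⟩

/-- The subgroup of relations coming from short exact sequences
`0 → A → B → C → 0` of finitely generated `R`-modules. -/
def G0Rels (R : Type u) [CommRing R] : AddSubgroup (FreeAbelianGroup (FGMod R)) :=
  AddSubgroup.closure
    { x | ∃ (A B C : FGMod R) (f : A.carrier →ₗ[R] B.carrier) (g : B.carrier →ₗ[R] C.carrier),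
        Function.Injective f ∧ Function.Surjective g ∧ LinearMap.range f = LinearMap.ker g ∧
        x = FreeAbelianGroup.of B - FreeAbelianGroup.of A - FreeAbelianGroup.of C }

/-- The Grothendieck group `G₀(R) = K₀(mod R)` of finitely generated `R`-modules:
the free abelian group on (finitely generated) modules modulo the relation
`[B] = [A] + [C]` for every short exact sequence `0 → A → B → C → 0`. -/
def G0 (R : Type u) [CommRing R] : Type (u + 1) :=
  FreeAbelianGroup (FGMod R) ⧸ G0Rels R

noncomputable instance (R : Type u) [CommRing R] : AddCommGroup (G0 R) :=
  inferInstanceAs (AddCommGroup (FreeAbelianGroup (FGMod R) ⧸ G0Rels R))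

/-- The class `[M]` of a finitely generated module in the Grothendieck group `G₀(R)`. -/
def G0.mk {R : Type u} [CommRing R] (M : FGMod R) : G0 R :=
  QuotientAddGroup.mk (FreeAbelianGroup.of M)

/-- In a module over a noetherian ring, every submodule of a finitely generated module is
finitely generated. -/
instance (R : Type u) [CommRing R] [IsNoetherianRing R] (M : Type u) [AddCommGroup M]
    [Module R M] [Module.Finite R M] (N : Submodule R M) : Module.Finite R ↥N := by
  haveI : IsNoetherian R M := isNoetherian_of_isNoetherianRing_of_finite R M
  exact Module.Finite.iff_fg.mpr (IsNoetherian.noetherian N)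

/-! ### Valuations at primes and the divisor class group -/

/-- The order (valuation) of `a` at the prime `p`: the supremum of the `n` such that `a`
lies in the `n`-th power of the maximal ideal `pR_p` of the localization `R_p`.  For the
localization at a height one prime of a normal noetherian domain, `R_p` is a discrete
valuation ring and this is the associated valuation `ν_p`. -/
noncomputable def ordAt (R : Type u) [CommRing R] (p : Ideal R) [p.IsPrime] (a : R) : ℕ∞ :=
  ⨆ n ∈ {n : ℕ | algebraMap R (Localization.AtPrime p) a ∈
      Ideal.map (algebraMap R (Localization.AtPrime p)) p ^ n}, (n : ℕ∞)

/-- The set of height one primes of `R`. -/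
def heightOnePrimes (R : Type u) [CommRing R] : Set (PrimeSpectrum R) :=
  { p | Order.height p = 1 }

/-- The group `Div R` of Weil divisors: the free abelian group on the height one primes. -/
abbrev DivisorGroup (R : Type u) [CommRing R] : Type u :=
  ↥(heightOnePrimes R) →₀ ℤ

/-- The set of principal Weil divisors: divisors of the form `div(a/b) = div(a) - div(b)`
for nonzero `a b : R`, where `div(a) = ∑_p ν_p(a)·p`. -/
def principalDivisors (R : Type u) [CommRing R] : Set (DivisorGroup R) :=
  { D | ∃ a b : R, a ≠ 0 ∧ b ≠ 0 ∧ ∃ va vb : ↥(heightOnePrimes R) → ℕ,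
      (∀ p : ↥(heightOnePrimes R),
          @ordAt R _ p.1.asIdeal p.1.isPrime a = va p ∧
          @ordAt R _ p.1.asIdeal p.1.isPrime b = vb p) ∧
      ∀ p : ↥(heightOnePrimes R), D p = (va p : ℤ) - (vb p : ℤ) }

/-- The (Weil) divisor class group of `R`: Weil divisors modulo principal divisors. -/
def ClassGrp (R : Type u) [CommRing R] : Type u :=
  DivisorGroup R ⧸ AddSubgroup.closure (principalDivisors R)

noncomputable instance (R : Type u) [CommRing R] : AddCommGroup (ClassGrp R) :=
  inferInstanceAs (AddCommGroup (DivisorGroup R ⧸ AddSubgroup.closure (principalDivisors R)))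

/-- The class of a height one prime in the divisor class group. -/
noncomputable def ClassGrp.mkPrime {R : Type u} [CommRing R] (p : ↥(heightOnePrimes R)) :
    ClassGrp R :=
  QuotientAddGroup.mk (Finsupp.single p 1)

open scoped TensorProduct

theorem length_coker_det {A : Type*} [CommRing A] [IsDomain A] [IsPrincipalIdealRing A]
    {M : Type*} [AddCommGroup M] [Module A M] [Module.Free A M] [Module.Finite A M]
    (T : M →ₗ[A] M) (hT : Function.Injective T) :
    Module.length A (M ⧸ LinearMap.range T) = Ring.ord A (LinearMap.det T) := by
  classical
  let b := Module.Free.chooseBasis A M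
  have h : Module.finrank A (LinearMap.range T) = Module.finrank A M :=
    (LinearEquiv.ofInjective T hT).finrank_eq.symm
  rw [(Submodule.quotientEquivPiSpan _ b h).length_eq, Module.length_pi_of_fintype]
  let b' := Submodule.smithNormalFormTopBasis b h
  let e : M ≃ₗ[A] M := (b'.equiv (Submodule.smithNormalFormBotBasis b h) (Equiv.refl _)).trans
      (LinearEquiv.ofInjective T hT).symm
  have key : Associated (LinearMap.det T) (∏ i, Submodule.smithNormalFormCoeffs b h i) := by
    rw [← Matrix.det_diagonal, ← LinearMap.det_toLin b']
    refine (LinearMap.associated_det_of_eq_comp e _ _ ?_).symm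
    intro x
    suffices h2 : Matrix.toLin b' b' (Matrix.diagonal (Submodule.smithNormalFormCoeffs b h))
        = T ∘ₗ e.toLinearMap from DFunLike.congr_fun h2 x
    refine b'.ext fun i => ?_
    have h3 : T (e (b' i)) = Submodule.smithNormalFormBotBasis b h i := by
      simp [e]
    rw [LinearMap.comp_apply, LinearEquiv.coe_toLinearMap, h3,
      Submodule.smithNormalFormBotBasis_def]
    simp [Matrix.toLin_self, Matrix.diagonal_apply, b']
  rw [Ring.ord_eq_of_associated key]
  have : ∀ s : Finset (Module.Free.ChooseBasisIndex A M),
      Ring.ord A (∏ i ∈ s, Submodule.smithNormalFormCoeffs b h i)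
        = ∑ i ∈ s, Ring.ord A (Submodule.smithNormalFormCoeffs b h i) := by
    intro s
    induction s using Finset.induction_on with
    | empty => simp
    | insert a s ha ih =>
      rw [Finset.prod_insert ha, Finset.sum_insert ha, Ring.ord_mul', ih]
      exact mem_nonZeroDivisors_of_ne_zero (Submodule.smithNormalFormCoeffs_ne_zero b h a)
  rw [this]
  rfl

theorem eq_of_le_heightOne {R : Type u} [CommRing R] [IsDomain R] (p : heightOnePrimes R)
   (q : PrimeSpectrum R) (hq : q.asIdeal ≠ ⊥) (h : q.asIdeal ≤ p.1.asIdeal) : q = p.1 := by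
  by_contra hne
  have hlt : q < p.1 := lt_of_le_of_ne h hne
  have h0 : (⊥ : PrimeSpectrum R) < q := bot_lt_iff_ne_bot.2 (by rintro rfl; exact hq rfl)
  have hp : Order.height p.1 = 1 := p.2
  have h1 := Order.height_add_one_le hlt
  have h2 := Order.height_add_one_le h0
  rw [hp] at h1
  have h3 : (1 : ℕ∞) ≤ Order.height q := le_trans (by simp) h2
  have h4 : (1 : ℕ∞) + 1 ≤ 1 := le_trans (by gcongr) h1
  exact absurd h4 (by decide)

theorem isDVR_of_heightOne {R : Type u} [CommRing R] [IsDomain R]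
    [IsNoetherianRing R] [IsIntegrallyClosed R] (p : heightOnePrimes R) :
    IsDiscreteValuationRing (Localization.AtPrime p.1.asIdeal) := by
  have hp : Order.height p.1 = 1 := p.2
  have hne : p.1.asIdeal ≠ ⊥ := by
    intro h
    have : p.1 = ⊥ := by ext1; exact h
    rw [this] at hp
    simp at hp
  have h1 : IsIntegrallyClosed (Localization.AtPrime p.1.asIdeal) :=
    isIntegrallyClosed_of_isLocalization _ p.1.asIdeal.primeCompl
      p.1.asIdeal.primeCompl_le_nonZeroDivisors 
  have hnf : ¬ IsField (Localization.AtPrime p.1.asIdeal) := by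
    rw [IsLocalRing.isField_iff_maximalIdeal_eq, ← Localization.AtPrime.map_eq_maximalIdeal]
    rw [Ideal.map_eq_bot_iff_of_injective]
    · exact hne
    · exact IsLocalization.injective _ p.1.asIdeal.primeCompl_le_nonZeroDivisors
  have hmax : IsLocalRing.maximalIdeal (Localization.AtPrime p.1.asIdeal) ≠ ⊥ :=
    IsLocalRing.isField_iff_maximalIdeal_eq.not.mp hnf
  have key : IsIntegrallyClosed (Localization.AtPrime p.1.asIdeal) ∧
      ∃! P : Ideal (Localization.AtPrime p.1.asIdeal), P ≠ ⊥ ∧ P.IsPrime := by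
    refine ⟨h1, _, ⟨hmax, inferInstance⟩, ?_⟩
    rintro P ⟨hP0, hP⟩
    have hmc := IsLocalization.map_under p.1.asIdeal.primeCompl
      (Localization.AtPrime p.1.asIdeal) P
    have hle : P.under R ≤ p.1.asIdeal := by
      have := Ideal.comap_mono (f := algebraMap R (Localization.AtPrime p.1.asIdeal))
        (IsLocalRing.le_maximalIdeal hP.ne_top)
      exact this.trans (IsLocalization.AtPrime.under_maximalIdeal _ p.1.asIdeal).le
    have := eq_of_le_heightOne p
      ⟨P.under R, inferInstance⟩ ?_ hle
    · have h5 := congrArg PrimeSpectrum.asIdeal this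
      simp only at h5
      rw [← hmc, h5, Localization.AtPrime.map_eq_maximalIdeal]
    · intro h0
      simp only at h0
      rw [h0, Ideal.map_bot] at hmc
      exact hP0 hmc.symm
  exact ((IsDiscreteValuationRing.TFAE _ hnf).out 0 3).mpr key

theorem ordAt_eq_ord {R : Type u} [CommRing R] [IsDomain R]
    [IsNoetherianRing R] [IsIntegrallyClosed R] (p : heightOnePrimes R) (a : R) (ha : a ≠ 0) :
    ∃ n : ℕ, ordAt R p.1.asIdeal a = n ∧
      Ring.ord (Localization.AtPrime p.1.asIdeal) (algebraMap R _ a) = n := by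
  have := isDVR_of_heightOne p
  have ha' : algebraMap R (Localization.AtPrime p.1.asIdeal) a ≠ 0 := by
    rw [Ne, FaithfulSMul.algebraMap_eq_zero_iff]; exact ha
  obtain ⟨ϖ, hϖ⟩ := IsDiscreteValuationRing.exists_irreducible (Localization.AtPrime p.1.asIdeal)
  obtain ⟨n, hn⟩ := IsDiscreteValuationRing.associated_pow_irreducible ha' hϖ
  refine ⟨n, ?_, ?_⟩
  · rw [ordAt, Localization.AtPrime.map_eq_maximalIdeal, hϖ.maximalIdeal_eq]
    apply le_antisymm
    · refine iSup₂_le fun k hk => ?_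
      simp only [Ideal.span_singleton_pow, Set.mem_ofPred_eq, Ideal.mem_span_singleton] at hk
      rw [hn.dvd_iff_dvd_right, pow_dvd_pow_iff hϖ.ne_zero hϖ.not_isUnit] at hk
      exact_mod_cast hk
    · refine le_iSup₂_of_le n ?_ le_rfl
      simp only [Ideal.span_singleton_pow, Set.mem_ofPred_eq, Ideal.mem_span_singleton]
      exact hn.symm.dvd
  · rw [Ring.ord_eq_of_associated hn, Ring.ord_pow (mem_nonZeroDivisors_of_ne_zero hϖ.ne_zero),
      Ring.ord_of_irreducible hϖ]
    simp

open scoped TensorProduct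

/-- `D` records the lengths of the localizations of `M` at height one primes. -/
def HasDiv {R : Type u} [CommRing R] (M : Type u) [AddCommGroup M] [Module R M]
    (D : heightOnePrimes R →₀ ℕ) : Prop :=
  ∀ p : heightOnePrimes R, Module.length (Localization.AtPrime p.1.asIdeal)
    (Localization.AtPrime p.1.asIdeal ⊗[R] M) = D p

section
variable {R : Type u} [CommRing R]

theorem HasDiv.unique {M : Type u} [AddCommGroup M] [Module R M] {D D' : heightOnePrimes R →₀ ℕ}
    (h : HasDiv M D) (h' : HasDiv M D') : D = D' := by
  ext p
  have := (h p).symm.trans (h' p)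
  exact_mod_cast this

theorem HasDiv.exact {A B C : Type u} [AddCommGroup A] [Module R A] [AddCommGroup B] [Module R B]
    [AddCommGroup C] [Module R C] {f : A →ₗ[R] B} {g : B →ₗ[R] C}
    (hf : Function.Injective f) (hg : Function.Surjective g) (hfg : Function.Exact f g)
    {D D' : heightOnePrimes R →₀ ℕ} (h : HasDiv A D) (h' : HasDiv C D') :
    HasDiv B (D + D') := by
  intro p
  have h1 : Function.Injective (f.baseChange (Localization.AtPrime p.1.asIdeal)) :=
    Module.Flat.lTensor_preserves_injective_linearMap _ hf
  have h2 : Function.Surjective (g.baseChange (Localization.AtPrime p.1.asIdeal)) :=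
    LinearMap.lTensor_surjective _ hg
  have h3 : Function.Exact (f.baseChange (Localization.AtPrime p.1.asIdeal))
      (g.baseChange (Localization.AtPrime p.1.asIdeal)) :=
    lTensor_exact _ hfg hg
  rw [Module.length_eq_add_of_exact _ _ h1 h2 h3, h p, h' p]
  simp

theorem HasDiv.congr {A B : Type u} [AddCommGroup A] [Module R A] [AddCommGroup B] [Module R B]
    (e : A ≃ₗ[R] B) {D : heightOnePrimes R →₀ ℕ} (h : HasDiv A D) : HasDiv B D := by
  intro p
  rw [← h p]
  exact (LinearEquiv.length_eq (LinearEquiv.baseChange R (Localization.AtPrime p.1.asIdeal)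
    A B e)).symm

theorem HasDiv.subsingleton {A : Type u} [AddCommGroup A] [Module R A] [Subsingleton A] :
    HasDiv (R := R) A 0 := by
  intro p
  simp

theorem HasDiv.quotient_eq_zero [IsDomain R] (q : PrimeSpectrum R) (hq : q.asIdeal ≠ ⊥)
    (h1 : q ∉ heightOnePrimes R) : HasDiv (R := R) (R ⧸ q.asIdeal) 0 := by
  intro p
  rw [← (Algebra.TensorProduct.quotIdealMapEquivTensorQuot
    (Localization.AtPrime p.1.asIdeal) q.asIdeal).toLinearEquiv.length_eq]
  have hle : ¬ q.asIdeal ≤ p.1.asIdeal := by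
    intro h
    apply h1
    rw [eq_of_le_heightOne p q hq h]
    exact p.2
  have hm : q.asIdeal.map (algebraMap R (Localization.AtPrime p.1.asIdeal)) = ⊤ := by
    obtain ⟨x, hx, hxp⟩ := SetLike.not_le_iff_exists.1 hle
    exact Ideal.eq_top_of_isUnit_mem _ (Ideal.mem_map_of_mem _ hx)
      (IsLocalization.map_units (M := p.1.asIdeal.primeCompl) _ ⟨x, hxp⟩)
  rw [Finsupp.coe_zero, Pi.zero_apply, Nat.cast_zero, Module.length_eq_zero_iff, hm]
  exact Ideal.Quotient.subsingleton_iff.2 rfl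

theorem HasDiv.quotient_eq_single [IsDomain R] (q : heightOnePrimes R) :
    HasDiv (R ⧸ q.1.asIdeal) (Finsupp.single q 1) := by
  intro p
  rw [← (Algebra.TensorProduct.quotIdealMapEquivTensorQuot
    (Localization.AtPrime p.1.asIdeal) q.1.asIdeal).toLinearEquiv.length_eq]
  have hq0 : q.1.asIdeal ≠ ⊥ := by
    intro h
    have hq : Order.height q.1 = 1 := q.2
    have : q.1 = ⊥ := by ext1; exact h
    rw [this] at hq
    simp at hq
  by_cases hpq : q = p
  · subst hpq
    rw [Localization.AtPrime.map_eq_maximalIdeal]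
    simp only [Finsupp.single_eq_same, Nat.cast_one]
    rw [Module.length_eq_one_iff,
      isSimpleModule_iff_isSimpleModule_of_algebraMap_surjective
        (S := (Localization.AtPrime q.1.asIdeal) ⧸
          IsLocalRing.maximalIdeal (Localization.AtPrime q.1.asIdeal))
        Ideal.Quotient.mk_surjective]
    let := Ideal.Quotient.field (IsLocalRing.maximalIdeal (Localization.AtPrime q.1.asIdeal))
    exact instIsSimpleModule _
  · have hle : ¬ q.1.asIdeal ≤ p.1.asIdeal := by
      intro h
      exact hpq (Subtype.ext (eq_of_le_heightOne p q.1 hq0 h))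
    have hm : q.1.asIdeal.map (algebraMap R (Localization.AtPrime p.1.asIdeal)) = ⊤ := by
      obtain ⟨x, hx, hxp⟩ := SetLike.not_le_iff_exists.1 hle
      exact Ideal.eq_top_of_isUnit_mem _ (Ideal.mem_map_of_mem _ hx)
        (IsLocalization.map_units (M := p.1.asIdeal.primeCompl) _ ⟨x, hxp⟩)
    rw [Finsupp.single_eq_of_ne (Ne.symm hpq), Nat.cast_zero, Module.length_eq_zero_iff, hm]
    exact Ideal.Quotient.subsingleton_iff.2 rfl

theorem G0.mk_exact {A B C : Type u} [AddCommGroup A] [Module R A] [Module.Finite R A]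
    [AddCommGroup B] [Module R B] [Module.Finite R B]
    [AddCommGroup C] [Module R C] [Module.Finite R C] (f : A →ₗ[R] B) (g : B →ₗ[R] C)
    (hf : Function.Injective f) (hg : Function.Surjective g) (hfg : Function.Exact f g) :
    G0.mk (FGMod.of R B) = G0.mk (FGMod.of R A) + G0.mk (FGMod.of R C) := by
  have h : (FreeAbelianGroup.of (FGMod.of R B) - FreeAbelianGroup.of (FGMod.of R A)
      - FreeAbelianGroup.of (FGMod.of R C)) ∈ G0Rels R :=
    AddSubgroup.subset_closure ⟨FGMod.of R A, FGMod.of R B, FGMod.of R C, f, g, hf, hg,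
      (LinearMap.exact_iff.1 hfg).symm, rfl⟩
  have h2 := (QuotientAddGroup.eq_zero_iff _).2 h
  have h3 : G0.mk (FGMod.of R B) - G0.mk (FGMod.of R A) - G0.mk (FGMod.of R C) = 0 := h2
  rw [← sub_eq_zero, ← h3]; abel

theorem G0.mk_subsingleton {A : Type u} [AddCommGroup A] [Module R A] [Module.Finite R A]
    [Subsingleton A] : G0.mk (FGMod.of R A) = 0 := by
  have := G0.mk_exact (0 : A →ₗ[R] A) (0 : A →ₗ[R] A) (Function.injective_of_subsingleton _)
    (fun x => ⟨0, Subsingleton.elim _ _⟩) (fun x => by simp [Subsingleton.elim x 0])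
  simpa using this

theorem G0.mk_congr {A B : Type u} [AddCommGroup A] [Module R A] [Module.Finite R A]
    [AddCommGroup B] [Module R B] [Module.Finite R B] (e : A ≃ₗ[R] B) :
    G0.mk (FGMod.of R A) = G0.mk (FGMod.of R B) := by
  have := G0.mk_exact (e : A →ₗ[R] B) (0 : B →ₗ[R] PUnit.{u+1}) e.injective
    (fun x => ⟨0, Subsingleton.elim _ _⟩) (fun x => by simp)
  rw [this, G0.mk_subsingleton (A := PUnit.{u+1}), add_zero]

theorem G0.mk_fin (n : ℕ) : G0.mk (FGMod.of R (Fin n → R)) = n • G0.mk (FGMod.of R R) := by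
  induction n with
  | zero => rw [G0.mk_subsingleton, zero_smul]
  | succ n ih =>
    rw [G0.mk_congr (Fin.consLinearEquiv R (fun _ : Fin (n+1) => R)).symm,
      G0.mk_exact (LinearMap.inl R R (Fin n → R)) (LinearMap.snd R R (Fin n → R))
        LinearMap.inl_injective LinearMap.snd_surjective .inl_snd]
    rw [ih, succ_nsmul, add_comm]

theorem G0.mk_free {F : Type u} [AddCommGroup F] [Module R F] [Module.Finite R F]
    [Module.Free R F] [Nontrivial R] :
    G0.mk (FGMod.of R F) = Module.finrank R F • G0.mk (FGMod.of R R) := by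
  rw [← G0.mk_fin]
  exact G0.mk_congr (Module.finBasis R F).equivFun

theorem finrank_exact [IsDomain R] [IsNoetherianRing R]
    {A B C : Type u} [AddCommGroup A] [Module R A]
    [AddCommGroup B] [Module R B] [Module.Finite R B]
    [AddCommGroup C] [Module R C] {f : A →ₗ[R] B} {g : B →ₗ[R] C}
    (hf : Function.Injective f) (hg : Function.Surjective g) (hfg : Function.Exact f g) :
    Module.finrank R B = Module.finrank R A + Module.finrank R C := by
  have h := Submodule.finrank_quotient_add_finrank (LinearMap.ker g)
  rw [(g.quotKerEquivOfSurjective hg).finrank_eq, LinearMap.exact_iff.1 hfg,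
    ← (LinearEquiv.ofInjective f hf).finrank_eq] at h
  omega

end

open scoped TensorProduct

/-- The subgroup generated by classes of codimension at least two. -/
noncomputable def G0H (R : Type u) [CommRing R] : AddSubgroup (G0 R) :=
  AddSubgroup.closure
    {x : G0 R | ∃ (q : Ideal R) (hq : q.IsPrime),
      2 ≤ Order.height (⟨q, hq⟩ : PrimeSpectrum R) ∧
      x = G0.mk (FGMod.of R (R ⧸ q))}

/-- The class in `G0 R` modulo codimension two. -/
noncomputable def piH {R : Type u} [CommRing R] : G0 R →+ G0 R ⧸ G0H R := QuotientAddGroup.mk' _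

/-- The map from divisors to `G0 R` modulo codimension two. -/
noncomputable def divToG0 (R : Type u) [CommRing R] : DivisorGroup R →+ G0 R ⧸ G0H R :=
  Finsupp.liftAddHom fun p => (zmultiplesHom _) (piH (G0.mk (FGMod.of R (R ⧸ p.1.asIdeal))))

/-- Effective divisors to divisors. -/
noncomputable def effDiv (R : Type u) [CommRing R] :
    (heightOnePrimes R →₀ ℕ) →+ DivisorGroup R :=
  Finsupp.mapRange.addMonoidHom (Nat.castAddMonoidHom ℤ)

/-- The class of an effective divisor. -/
noncomputable def divCl (R : Type u) [CommRing R] :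
    (heightOnePrimes R →₀ ℕ) →+ ClassGrp R :=
  (QuotientAddGroup.mk' (AddSubgroup.closure (principalDivisors R))).comp (effDiv R)

section
variable {R : Type u} [CommRing R] [IsDomain R] [IsNoetherianRing R]

theorem exists_hasDiv {M : Type u} [AddCommGroup M] [Module R M] [hM : Module.Finite R M]
    (hr : Module.finrank R M = 0) :
    ∃ D, HasDiv M D ∧ piH (G0.mk (FGMod.of R M)) = divToG0 R (effDiv R D) := by
  revert hr
  induction hM using
    IsNoetherianRing.induction_on_isQuotientEquivQuotientPrime R with
  | subsingleton N =>
    intro _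
    exact ⟨0, HasDiv.subsingleton, by rw [G0.mk_subsingleton]; simp⟩
  | quotient N q e =>
    intro hr
    have hq : q.asIdeal ≠ ⊥ := by
      intro h
      have e2 : N ≃ₗ[R] R := e.trans (Submodule.quotEquivOfEqBot _ h)
      rw [e2.finrank_eq] at hr
      simp at hr
    by_cases h1 : q ∈ heightOnePrimes R
    · refine ⟨Finsupp.single ⟨q, h1⟩ 1, (HasDiv.quotient_eq_single ⟨q, h1⟩).congr e.symm, ?_⟩
      rw [G0.mk_congr e]
      simp [effDiv, divToG0]
    · refine ⟨0, (HasDiv.quotient_eq_zero q hq h1).congr e.symm, ?_⟩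
      rw [G0.mk_congr e, map_zero, map_zero]
      refine (QuotientAddGroup.eq_zero_iff _).2 (AddSubgroup.subset_closure ?_)
      refine ⟨q.asIdeal, q.isPrime, ?_, rfl⟩
      have h0 : (⊥ : PrimeSpectrum R) < q := bot_lt_iff_ne_bot.2 (by rintro rfl; exact hq rfl)
      have h2 := Order.height_add_one_le h0
      have h3 : (1 : ℕ∞) ≤ Order.height q := le_trans (by simp) h2
      have h4 : (1 : ℕ∞) < Order.height q := lt_of_le_of_ne h3 (fun h => h1 h.symm)
      have h5 := Order.add_one_le_of_lt h4
      rw [one_add_one_eq_two] at h5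
      exact h5
  | exact A B C f g hf hg hfg ihA ihC =>
    intro hr
    have h := finrank_exact hf hg hfg
    obtain ⟨D, hD, hD'⟩ := ihA (by omega)
    obtain ⟨E, hE, hE'⟩ := ihC (by omega)
    exact ⟨D + E, hD.exact hf hg hfg hE, by rw [G0.mk_exact f g hf hg hfg]; simp [hD', hE']⟩

theorem HasDiv.eq_divToG0 {M : Type u} [AddCommGroup M] [Module R M] [Module.Finite R M]
    (hr : Module.finrank R M = 0) {D} (hD : HasDiv M D) :
    piH (G0.mk (FGMod.of R M)) = divToG0 R (effDiv R D) := by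
  obtain ⟨E, hE, h⟩ := exists_hasDiv hr
  rw [hD.unique hE, h]

theorem finrank_coker {F M : Type u} [AddCommGroup M] [Module R M] [Module.Finite R M]
    [AddCommGroup F] [Module R F] {j : F →ₗ[R] M} (hj : Function.Injective j)
    (h : Module.finrank R F = Module.finrank R M) :
    Module.finrank R (M ⧸ LinearMap.range j) = 0 := by
  have h2 := Submodule.finrank_quotient_add_finrank (LinearMap.range j)
  rw [← (LinearEquiv.ofInjective j hj).finrank_eq] at h2
  omega

theorem G0.mk_coker {F M : Type u} [AddCommGroup M] [Module R M] [Module.Finite R M]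
    [AddCommGroup F] [Module R F] [Module.Finite R F] {j : F →ₗ[R] M}
    (hj : Function.Injective j) :
    G0.mk (FGMod.of R M) = G0.mk (FGMod.of R F) + G0.mk (FGMod.of R (M ⧸ LinearMap.range j)) :=
  G0.mk_exact j (LinearMap.range j).mkQ hj (Submodule.mkQ_surjective _)
    (LinearMap.exact_map_mkQ_range j)

/-- The divisor of the cokernel of an injective endomorphism is given by the determinant. -/
theorem HasDiv.det [IsIntegrallyClosed R] {F : Type u} [AddCommGroup F] [Module R F]
    [Module.Finite R F] [Module.Free R F] (T : F →ₗ[R] F) (hT : Function.Injective T)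
    {D : heightOnePrimes R →₀ ℕ} (hD : HasDiv (F ⧸ LinearMap.range T) D) :
    LinearMap.det T ≠ 0 ∧ ∀ p : heightOnePrimes R, ordAt R p.1.asIdeal (LinearMap.det T) = D p := by
  have h0 : LinearMap.det T ≠ 0 := by
    intro h
    have := LinearMap.bot_lt_ker_of_det_eq_zero h
    simp [LinearMap.ker_eq_bot.2 hT] at this
  refine ⟨h0, fun p => ?_⟩
  have := isDVR_of_heightOne p
  obtain ⟨n, h1, h2⟩ := ordAt_eq_ord p _ h0
  rw [h1, ← h2, ← hD p, ← LinearMap.det_baseChange, ← length_coker_det]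
  · have hex : Function.Exact (T.baseChange (Localization.AtPrime p.1.asIdeal))
        ((LinearMap.range T).mkQ.baseChange (Localization.AtPrime p.1.asIdeal)) :=
      lTensor_exact _ (LinearMap.exact_map_mkQ_range T) (Submodule.mkQ_surjective _)
    have hs : Function.Surjective
        ((LinearMap.range T).mkQ.baseChange (Localization.AtPrime p.1.asIdeal)) :=
      LinearMap.lTensor_surjective _ (Submodule.mkQ_surjective _)
    rw [← (LinearMap.quotKerEquivOfSurjective _ hs).length_eq, LinearMap.exact_iff.1 hex]
  · exact Module.Flat.lTensor_preserves_injective_linearMap _ hT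

theorem ordAt_one [IsIntegrallyClosed R] (p : heightOnePrimes R) :
    ordAt R p.1.asIdeal 1 = (0 : ℕ) := by
  obtain ⟨n, h1, h2⟩ := ordAt_eq_ord p 1 one_ne_zero
  rw [h1, ← h2]
  simp

theorem HasDiv.divCl_eq_zero [IsIntegrallyClosed R] {F : Type u} [AddCommGroup F] [Module R F]
    [Module.Finite R F] [Module.Free R F] (T : F →ₗ[R] F) (hT : Function.Injective T)
    {D : heightOnePrimes R →₀ ℕ} (hD : HasDiv (F ⧸ LinearMap.range T) D) :
    divCl R D = 0 := by
  obtain ⟨h0, h⟩ := hD.det T hT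
  refine (QuotientAddGroup.eq_zero_iff _).2 (AddSubgroup.subset_closure ?_)
  refine ⟨LinearMap.det T, 1, h0, one_ne_zero, fun p => D p, fun p => 0, fun p => ⟨h p, ?_⟩, ?_⟩
  · exact ordAt_one p
  · intro p
    simp [effDiv]

theorem HasDiv.comp {F F' M : Type u} [AddCommGroup M] [Module R M] 
    [AddCommGroup F] [Module R F] [AddCommGroup F'] [Module R F'] (S : F' →ₗ[R] F)
    {j : F →ₗ[R] M} (hj : Function.Injective j) {D E : heightOnePrimes R →₀ ℕ}
    (hD : HasDiv (F ⧸ LinearMap.range S) D) (hE : HasDiv (M ⧸ LinearMap.range j) E) :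
    HasDiv (M ⧸ LinearMap.range (j ∘ₗ S)) (D + E) := by
  have hle : LinearMap.range (j ∘ₗ S) ≤ LinearMap.range j := LinearMap.range_comp_le_range _ _
  have hle2 : LinearMap.range S ≤ (LinearMap.range (j ∘ₗ S)).comap j := by
    rintro _ ⟨x, rfl⟩
    exact ⟨x, rfl⟩
  refine HasDiv.exact (f := Submodule.mapQ _ _ j hle2) (g := Submodule.factor hle) ?_
    (Submodule.factor_surjective hle) ?_ hD hE
  · rw [injective_iff_map_eq_zero]
    intro x
    obtain ⟨x, rfl⟩ := Submodule.Quotient.mk_surjective _ x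
    rw [Submodule.mapQ_apply, Submodule.Quotient.mk_eq_zero, Submodule.Quotient.mk_eq_zero]
    rintro ⟨y, hy⟩
    exact ⟨y, hj hy⟩
  · intro x
    obtain ⟨x, rfl⟩ := Submodule.Quotient.mk_surjective _ x
    have hx : Submodule.factor hle (Submodule.Quotient.mk x) = Submodule.Quotient.mk x := rfl
    rw [hx, Submodule.Quotient.mk_eq_zero]
    constructor
    · rintro ⟨y, rfl⟩
      exact ⟨Submodule.Quotient.mk y, rfl⟩
    · rintro ⟨y, hy⟩
      obtain ⟨y, rfl⟩ := Submodule.Quotient.mk_surjective _ y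
      rw [Submodule.mapQ_apply, Submodule.Quotient.eq] at hy
      have := hle hy
      have h3 := Submodule.sub_mem (LinearMap.range j) (LinearMap.mem_range_self j y) this
      simpa using h3

theorem HasDiv.indep [IsIntegrallyClosed R] {F F' M : Type u} [AddCommGroup M] [Module R M]
    [Module.Finite R M] [AddCommGroup F] [Module R F] [Module.Finite R F] [Module.Free R F]
    [AddCommGroup F'] [Module R F'] [Module.Finite R F'] [Module.Free R F']
    {j : F →ₗ[R] M} (hj : Function.Injective j) (hF : Module.finrank R F = Module.finrank R M)
    {j' : F' →ₗ[R] M} (hj' : Function.Injective j')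
    (hF' : Module.finrank R F' = Module.finrank R M) {D D' : heightOnePrimes R →₀ ℕ}
    (hD : HasDiv (M ⧸ LinearMap.range j) D) (hD' : HasDiv (M ⧸ LinearMap.range j') D') :
    divCl R D = divCl R D' := by
  have htor : Module.IsTorsion R (M ⧸ LinearMap.range j') :=
    Module.finrank_eq_zero_iff_isTorsion.1 (finrank_coker hj' hF')
  obtain ⟨a, ha0, ha⟩ : ∃ a : R, a ≠ 0 ∧ ∀ x : M, a • x ∈ LinearMap.range j' := by
    obtain ⟨a, ha, ha0⟩ := Submodule.annihilator_top_inter_nonZeroDivisors htor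
    refine ⟨a, nonZeroDivisors.ne_zero ha0, fun x => ?_⟩
    have := Submodule.mem_annihilator.1 ha (Submodule.Quotient.mk x) trivial
    rwa [← Submodule.Quotient.mk_smul, Submodule.Quotient.mk_eq_zero] at this
  let ψ : F →ₗ[R] F' := (LinearEquiv.ofInjective j' hj').symm.toLinearMap ∘ₗ
    LinearMap.codRestrict (LinearMap.range j') (a • j) (fun x => ha (j x))
  have hψ : j' ∘ₗ ψ = j ∘ₗ (a • LinearMap.id) := by
    ext x
    simp [ψ]
  have hai : Function.Injective (a • (LinearMap.id : F →ₗ[R] F)) := by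
    intro x y hxy
    exact smul_right_injective F ha0 hxy
  have hψi : Function.Injective ψ := by
    have : Function.Injective (j' ∘ₗ ψ) := by
      rw [hψ]
      exact hj.comp hai
    exact Function.Injective.of_comp this
  let e : F' ≃ₗ[R] F := LinearEquiv.ofFinrankEq _ _ (by omega)
  obtain ⟨D1, hD1, -⟩ := exists_hasDiv (finrank_coker hai rfl)
  have hψei : Function.Injective (ψ ∘ₗ e.toLinearMap) := hψi.comp e.injective
  obtain ⟨D2, hD2, -⟩ := exists_hasDiv (finrank_coker hψei rfl)
  have z1 := hD1.divCl_eq_zero _ hai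
  have z2 := hD2.divCl_eq_zero _ hψei
  rw [LinearMap.range_comp_of_range_eq_top _ (LinearMap.range_eq_top.2 e.surjective)] at hD2
  have k1 := hD1.comp _ hj hD
  have k2 := hD2.comp _ hj' hD'
  rw [hψ] at k2
  have := congrArg (divCl R) (k1.unique k2)
  simpa [z1, z2] using this

/-- `x` is the class attached to `M`. -/
def IsCls (M : Type u) [AddCommGroup M] [Module R M] (x : ClassGrp R) : Prop :=
  ∃ (F : Type u) (_ : AddCommGroup F) (_ : Module R F) (_ : Module.Finite R F)
    (_ : Module.Free R F) (j : F →ₗ[R] M) (D : heightOnePrimes R →₀ ℕ),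
    Function.Injective j ∧ Module.finrank R F = Module.finrank R M ∧
    HasDiv (M ⧸ LinearMap.range j) D ∧ x = divCl R D

theorem IsCls.unique [IsIntegrallyClosed R] {M : Type u} [AddCommGroup M] [Module R M]
    [Module.Finite R M] {x y : ClassGrp R} (hx : IsCls M x) (hy : IsCls M y) : x = y := by
  obtain ⟨F, _, _, _, _, j, D, h1, h2, h3, rfl⟩ := hx
  obtain ⟨F', _, _, _, _, j', D', h1', h2', h3', rfl⟩ := hy
  exact HasDiv.indep h1 h2 h1' h2' h3 h3'

theorem IsCls.exists (M : Type u) [AddCommGroup M] [Module R M]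
    [Module.Finite R M] : ∃ x : ClassGrp R, IsCls M x := by
  obtain ⟨s, hs, hli⟩ := exists_set_linearIndependent R M
  have hfin : Finite s := by
    rw [← Module.finrank_eq_rank] at hs
    exact Cardinal.lt_aleph0_iff_finite.1 (hs ▸ Cardinal.natCast_lt_aleph0)
  have hli' : LinearIndependent R ((↑) : s → M) := hli
  have := Fintype.ofFinite s
  have hj : Function.Injective (Fintype.linearCombination R ((↑) : s → M)) :=
    linearIndependent_iff_injective_fintypeLinearCombination.1 hli'
  have hr : Module.finrank R (s → R) = Module.finrank R M := by
    rw [Module.finrank_fintype_fun_eq_card, Module.finrank, ← hs]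
    simp
  obtain ⟨D, hD, -⟩ := exists_hasDiv (finrank_coker hj hr)
  exact ⟨_, (s → R), _, _, inferInstance, inferInstance, _, D, hj, hr, hD, rfl⟩

theorem IsCls.exact {A B C : Type u} [AddCommGroup A] [Module R A] [AddCommGroup B] [Module R B]
    [Module.Finite R B] [AddCommGroup C] [Module R C] {f : A →ₗ[R] B} {g : B →ₗ[R] C}
    (hf : Function.Injective f) (hg : Function.Surjective g) (hfg : Function.Exact f g)
    {x y : ClassGrp R} (hx : IsCls A x) (hy : IsCls C y) : IsCls B (x + y) := by
  obtain ⟨F, _, _, _, _, j, D, h1, h2, h3, rfl⟩ := hx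
  obtain ⟨F', _, _, _, _, j', D', h1', h2', h3', rfl⟩ := hy
  obtain ⟨σ, hσ⟩ := Module.projective_lifting_property g j' hg
  have hσ' : ∀ c, g (σ c) = j' c := fun c => DFunLike.congr_fun hσ c
  have hgf : ∀ a, g (f a) = 0 := fun a => (hfg _).2 ⟨a, rfl⟩
  let h : F × F' →ₗ[R] B := LinearMap.coprod (f ∘ₗ j) σ
  have hh : ∀ a c, h (a, c) = f (j a) + σ c := fun a c => by simp [h]
  refine ⟨F × F', _, _, inferInstance, inferInstance, h, D + D', ?_, ?_, ?_, (map_add _ _ _).symm⟩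
  · rw [injective_iff_map_eq_zero]
    rintro ⟨a, c⟩ hac
    rw [hh] at hac
    have hc : c = 0 := by
      have := congrArg g hac
      rw [map_add, hgf, hσ', zero_add, map_zero] at this
      exact h1' (by simpa using this)
    subst hc
    rw [map_zero, add_zero] at hac
    have : a = 0 := h1 (hf (by simpa using hac))
    rw [this]; rfl
  · rw [Module.finrank_prod, finrank_exact hf hg hfg, h2, h2']
  · have le1 : LinearMap.range j ≤ (LinearMap.range h).comap f := by
      rintro _ ⟨a, rfl⟩
      exact ⟨(a, 0), by simp [hh]⟩
    have le2 : LinearMap.range h ≤ (LinearMap.range j').comap g := by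
      rintro _ ⟨⟨a, c⟩, rfl⟩
      exact ⟨c, by simp [hh, hgf, hσ']⟩
    refine HasDiv.exact (f := Submodule.mapQ _ _ f le1) (g := Submodule.mapQ _ _ g le2)
      ?_ ?_ ?_ h3 h3'
    · rw [injective_iff_map_eq_zero]
      intro x
      obtain ⟨x, rfl⟩ := Submodule.Quotient.mk_surjective _ x
      rw [Submodule.mapQ_apply, Submodule.Quotient.mk_eq_zero, Submodule.Quotient.mk_eq_zero]
      rintro ⟨⟨a, c⟩, hy⟩
      rw [hh] at hy
      have hc : c = 0 := by
        have := congrArg g hy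
        rw [map_add, hgf, hσ', zero_add, hgf] at this
        exact h1' (by simpa using this)
      subst hc
      rw [map_zero, add_zero] at hy
      exact ⟨a, hf hy⟩
    · intro z
      obtain ⟨z, rfl⟩ := Submodule.Quotient.mk_surjective _ z
      obtain ⟨b, rfl⟩ := hg z
      exact ⟨Submodule.Quotient.mk b, rfl⟩
    · intro z
      obtain ⟨z, rfl⟩ := Submodule.Quotient.mk_surjective _ z
      rw [Submodule.mapQ_apply, Submodule.Quotient.mk_eq_zero]
      constructor
      · rintro ⟨c, hc⟩
        have : g (z - σ c) = 0 := by rw [map_sub, hσ', hc, sub_self]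
        obtain ⟨a, ha⟩ := (hfg _).1 this
        refine ⟨Submodule.Quotient.mk a, ?_⟩
        rw [Submodule.mapQ_apply, Submodule.Quotient.eq]
        exact ⟨(0, -c), by simp [hh, ha]⟩
      · rintro ⟨a, ha⟩
        obtain ⟨a, rfl⟩ := Submodule.Quotient.mk_surjective _ a
        rw [Submodule.mapQ_apply, Submodule.Quotient.eq] at ha
        have := le2 ha
        simp only [Submodule.mem_comap, map_sub, hgf, zero_sub] at this
        exact (Submodule.neg_mem_iff _).1 this

theorem IsCls.of_torsion {M : Type u} [AddCommGroup M] [Module R M] 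
    (hM : Module.finrank R M = 0) {D} (hD : HasDiv M D) : IsCls M (divCl R D) := by
  refine ⟨PUnit.{u+1}, _, _, inferInstance, inferInstance, 0, D,
    Function.injective_of_subsingleton _, ?_, ?_, rfl⟩
  · rw [hM]; exact Module.finrank_zero_of_subsingleton
  · exact hD.congr (Submodule.quotEquivOfEqBot _ (by simp)).symm

end

open scoped TensorProduct

section
variable (R : Type u) [CommRing R] [IsDomain R] [IsNoetherianRing R]

/-- The rank map. -/
noncomputable def rankHom : G0 R →+ ℤ :=
  QuotientAddGroup.lift (G0Rels R)
    (FreeAbelianGroup.lift fun M : FGMod R => (Module.finrank R M.carrier : ℤ)) (by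
      rw [G0Rels, AddSubgroup.closure_le]
      rintro _ ⟨A, B, C, f, g, hf, hg, hfg, rfl⟩
      have := finrank_exact hf hg (LinearMap.exact_iff.2 hfg.symm)
      simp [this])

theorem rankHom_mk (M : FGMod R) : rankHom R (G0.mk M) = Module.finrank R M.carrier := by
  refine (QuotientAddGroup.lift_mk' _ _ _).trans ?_
  simp

/-- The class map on modules. -/
noncomputable def clsFun (M : FGMod R) : ClassGrp R :=
  (IsCls.exists (R := R) M.carrier).choose

theorem clsFun_spec (M : FGMod R) : IsCls M.carrier (clsFun R M) :=
  (IsCls.exists (R := R) M.carrier).choose_spec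

variable [IsIntegrallyClosed R]

/-- The first Chern class map. -/
noncomputable def clsHom : G0 R →+ ClassGrp R :=
  QuotientAddGroup.lift (G0Rels R) (FreeAbelianGroup.lift (clsFun R)) (by
      rw [G0Rels, AddSubgroup.closure_le]
      rintro _ ⟨A, B, C, f, g, hf, hg, hfg, rfl⟩
      have := (clsFun_spec R B).unique ((clsFun_spec R A).exact hf hg
        (LinearMap.exact_iff.2 hfg.symm) (clsFun_spec R C))
      simp [this])

theorem clsHom_mk (M : FGMod R) : clsHom R (G0.mk M) = clsFun R M := by
  refine (QuotientAddGroup.lift_mk' _ _ _).trans ?_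
  simp

theorem exists_div_elem (a : R) (ha : a ≠ 0) : ∃ D : heightOnePrimes R →₀ ℕ,
    (∀ p : heightOnePrimes R, ordAt R p.1.asIdeal a = D p) ∧ divToG0 R (effDiv R D) = 0 := by
  let T : R →ₗ[R] R := LinearMap.mulLeft R a
  have hT : Function.Injective T := fun x y h => mul_left_cancel₀ ha h
  have h0 := finrank_coker hT rfl
  obtain ⟨D, hD, hD'⟩ := exists_hasDiv h0
  have hdet : LinearMap.det T = a := by
    have : T = a • LinearMap.id := by ext; simp [T]
    rw [this, LinearMap.det_smul]; simp
  refine ⟨D, fun p => ?_, ?_⟩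
  · have := (hD.det T hT).2 p
    rwa [hdet] at this
  · rw [← hD']
    have := G0.mk_coker hT
    rw [left_eq_add] at this
    rw [this, map_zero]

/-- The map from the class group to `G0` modulo codimension two. -/
noncomputable def clToG0 : ClassGrp R →+ G0 R ⧸ G0H R :=
  QuotientAddGroup.lift (AddSubgroup.closure (principalDivisors R)) (divToG0 R) (by
    rw [AddSubgroup.closure_le]
    rintro D ⟨a, b, ha, hb, va, vb, h1, h2⟩
    obtain ⟨Da, hDa, za⟩ := exists_div_elem R a ha
    obtain ⟨Db, hDb, zb⟩ := exists_div_elem R b hb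
    have : D = effDiv R Da - effDiv R Db := by
      ext p
      have e1 : va p = Da p := by exact_mod_cast (h1 p).1.symm.trans (hDa p)
      have e2 : vb p = Db p := by exact_mod_cast (h1 p).2.symm.trans (hDb p)
      rw [h2 p, e1, e2]
      simp [effDiv]
    simp [this, za, zb])

theorem clToG0_divCl (D : heightOnePrimes R →₀ ℕ) :
    clToG0 R (divCl R D) = divToG0 R (effDiv R D) := rfl

theorem mk_eq_rank_add_cls (M : FGMod R) :
    piH (G0.mk M) = rankHom R (G0.mk M) • piH (G0.mk (FGMod.of R R)) +
      clToG0 R (clsHom R (G0.mk M)) := by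
  obtain ⟨F, _, _, _, _, j, D, h1, h2, h3, h4⟩ := clsFun_spec R M
  rw [clsHom_mk, h4, clToG0_divCl, ← h3.eq_divToG0 (finrank_coker h1 h2), rankHom_mk, ← h2]
  have := G0.mk_coker h1
  rw [G0.mk_free (F := F)] at this
  have h5 := congrArg (piH (R := R)) this
  rw [map_add, map_nsmul] at h5
  rw [natCast_zsmul]
  exact h5

theorem eq_rank_add_cls (x : G0 R) :
    piH x = rankHom R x • piH (G0.mk (FGMod.of R R)) + clToG0 R (clsHom R x) := by
  let φ : G0 R →+ G0 R ⧸ G0H R :=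
    ((zmultiplesHom _) (piH (G0.mk (FGMod.of R R)))).comp (rankHom R) +
      (clToG0 R).comp (clsHom R)
  have hφ : (piH : G0 R →+ G0 R ⧸ G0H R) = φ := by
    refine QuotientAddGroup.addMonoidHom_ext _ (FreeAbelianGroup.lift_ext _ _ fun M => ?_)
    exact mk_eq_rank_add_cls R M
  exact DFunLike.congr_fun hφ x

theorem finrank_quot_eq_zero (q : Ideal R) (hq : q ≠ ⊥) : Module.finrank R (R ⧸ q) = 0 := by
  rw [Module.finrank_eq_zero_iff]
  intro x
  obtain ⟨a, ha, ha0⟩ := Submodule.exists_mem_ne_zero_of_ne_bot hq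
  refine ⟨a, ha0, ?_⟩
  obtain ⟨x, rfl⟩ := Ideal.Quotient.mk_surjective x
  rw [← Ideal.Quotient.mk_eq_mk, ← Submodule.Quotient.mk_smul, Submodule.Quotient.mk_eq_zero]
  exact q.mul_mem_right _ ha

theorem ne_bot_of_height {q : PrimeSpectrum R} (hq : 1 ≤ Order.height q) : q.asIdeal ≠ ⊥ := by
  intro h
  have : q = ⊥ := by ext1; exact h
  rw [this] at hq
  simp at hq

theorem clsHom_prime (p : heightOnePrimes R) :
    clsHom R (G0.mk (FGMod.of R (R ⧸ p.1.asIdeal))) = ClassGrp.mkPrime p := by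
  rw [clsHom_mk]
  have hp : p.1.asIdeal ≠ ⊥ := ne_bot_of_height R (show Order.height p.1 = 1 from p.2).ge
  have h1 := IsCls.of_torsion (finrank_quot_eq_zero R _ hp) (HasDiv.quotient_eq_single p)
  rw [(clsFun_spec R (FGMod.of R (R ⧸ p.1.asIdeal))).unique h1]
  refine congrArg (QuotientAddGroup.mk' (AddSubgroup.closure (principalDivisors R))) ?_
  simp [effDiv]

theorem clsHom_H : G0H R ≤ (clsHom R).ker := by
  rw [G0H, AddSubgroup.closure_le]
  rintro _ ⟨q, hq, h2, rfl⟩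
  have hq0 := ne_bot_of_height R (le_trans (by norm_num) h2)
  have hn : (⟨q, hq⟩ : PrimeSpectrum R) ∉ heightOnePrimes R := by
    intro h
    have h : Order.height (⟨q, hq⟩ : PrimeSpectrum R) = 1 := h
    rw [h] at h2
    exact absurd h2 (by decide)
  have h1 := IsCls.of_torsion (finrank_quot_eq_zero R _ hq0) (HasDiv.quotient_eq_zero _ hq0 hn)
  have h3 := (clsFun_spec R (FGMod.of R (R ⧸ q))).unique h1
  simp [clsHom_mk, h3]

end

/-- **The reduced Grothendieck group modulo codimension-two classes is the class group.**
Let `R` be a normal (= integrally closed) noetherian integral domain.  Let `ρ` be the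
rank map `G₀(R) → ℤ`, `[M] ↦ dim_{Q(R)}(M ⊗ Q(R))`, let `G̃₀(R) = ker ρ` be the reduced
Grothendieck group, and let `H ⊆ G̃₀(R)` be the subgroup generated by all classes
`[R/𝔮]` with `𝔮` a prime of height at least `2`.  Then the natural map (sending the
class of `[R/𝔭]`, for `𝔭` of height one, to the class of the prime divisor `𝔭`)
induces an isomorphism `G̃₀(R)/H ≅ Cl(R)`. -/
theorem reduced_g0_mod_heightTwo_iso_classGroup (R : Type u) [CommRing R] [IsDomain R]
    [IsNoetherianRing R] [IsIntegrallyClosed R] :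
    ∃ ρ : G0 R →+ ℤ,
      (∀ M : FGMod R, ρ (G0.mk M) =
          Module.finrank (FractionRing R) (TensorProduct R (FractionRing R) M.carrier)) ∧
      ∃ e : (↥ρ.ker ⧸ (AddSubgroup.closure
              {x : G0 R | ∃ (q : Ideal R) (hq : q.IsPrime),
                2 ≤ Order.height (⟨q, hq⟩ : PrimeSpectrum R) ∧
                x = G0.mk (FGMod.of R (R ⧸ q))}).addSubgroupOf ρ.ker) ≃+ ClassGrp R,
        ∀ (p : ↥(heightOnePrimes R))
          (h : G0.mk (FGMod.of R (R ⧸ p.1.asIdeal)) ∈ ρ.ker),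
          e (QuotientAddGroup.mk ⟨G0.mk (FGMod.of R (R ⧸ p.1.asIdeal)), h⟩) =
            ClassGrp.mkPrime p := by
  refine ⟨rankHom R, fun M => ?_, ?_⟩
  · rw [rankHom_mk]
    congr 1
    exact ((TensorProduct.isBaseChange R M.carrier (FractionRing R)).finrank_eq).symm
  · let c : (rankHom R).ker →+ ClassGrp R := (clsHom R).comp (rankHom R).ker.subtype
    let φ : ((rankHom R).ker ⧸ (G0H R).addSubgroupOf (rankHom R).ker) →+ ClassGrp R :=
      QuotientAddGroup.lift _ c (fun x hx => clsHom_H R hx)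
    have hφ : ∀ x, φ (QuotientAddGroup.mk x) = clsHom R x.1 := fun x => rfl
    have hbij : Function.Bijective φ := by
      constructor
      · rw [injective_iff_map_eq_zero]
        intro x
        obtain ⟨x, rfl⟩ := QuotientAddGroup.mk_surjective x
        intro hx
        rw [hφ] at hx
        have h1 := eq_rank_add_cls R x.1
        have h2 : rankHom R x.1 = 0 := x.2
        rw [hx, h2, zero_smul, map_zero, add_zero] at h1
        exact (QuotientAddGroup.eq_zero_iff _).2 ((QuotientAddGroup.eq_zero_iff (N := G0H R) x.1).1 h1)
      · have hs : ∀ D : DivisorGroup R, (QuotientAddGroup.mk D : ClassGrp R) ∈ φ.range := by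
          intro D
          induction D using Finsupp.induction_linear with
          | zero => exact zero_mem _
          | add f g hf hg => exact add_mem hf hg
          | single p n =>
            have hp : p.1.asIdeal ≠ ⊥ :=
              ne_bot_of_height R (show Order.height p.1 = 1 from p.2).ge
            have hk : G0.mk (FGMod.of R (R ⧸ p.1.asIdeal)) ∈ (rankHom R).ker := by
              rw [AddMonoidHom.mem_ker, rankHom_mk]
              exact_mod_cast finrank_quot_eq_zero R _ hp
            have h1 : ClassGrp.mkPrime p ∈ φ.range :=
              ⟨QuotientAddGroup.mk ⟨_, hk⟩, (hφ _).trans (clsHom_prime R p)⟩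
            have h2 := zsmul_mem h1 n
            have h3 : (Finsupp.single p n : DivisorGroup R) = n • Finsupp.single p 1 := by simp
            rw [h3]
            exact h2
        intro y
        obtain ⟨D, rfl⟩ := QuotientAddGroup.mk_surjective y
        exact hs D
    exact ⟨AddEquiv.ofBijective φ hbij, fun p h => clsHom_prime R p⟩
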